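/- arXiv:2409.07820 — 5 statements merged into one kernel-verified Lean document; each statement's English description precedes it below -/
import Mathlib

section
/- For every integer k ≥ 1 and every real σ > 2 there exists a map ψ : ℝ^k → ℝ^k of class C^∞ with compact support such that ψ(y) = y whenever |y| ≤ 1, ψ(y) = 0 whenever |y| ≥ σ, |ψ(y)| ≤ σ for every y ∈ ℝ^k, and ψ is 1-Lipschitz, i.e. |ψ(y) − ψ(z)| ≤ |y − z| for all y, z ∈ ℝ^k. -/
open MeasureTheory in
/-- Mollifying a `1`-Lipschitz map by a normalized bump function keeps it `1`-Lipschitz. -/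
theorem norm_convolution_normed_sub_le {E : Type*} [NormedAddCommGroup E] [InnerProductSpace ℝ E]
    [FiniteDimensional ℝ E] [MeasurableSpace E] [BorelSpace E]
    (f : ContDiffBump (0 : E)) {Φ : E → E}
    (hΦ : ∀ y z, ‖Φ y - Φ z‖ ≤ ‖y - z‖) (hc : Continuous Φ) (y z : E) :
    ‖(∫ t, f.normed volume t • Φ (y - t)) - ∫ t, f.normed volume t • Φ (z - t)‖
      ≤ ‖y - z‖ := by
  have hint (x : E) : Integrable (fun t => f.normed volume t • Φ (x - t)) :=
    (f.continuous_normed.smul (by fun_prop)).integrable_of_hasCompactSupport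
      f.hasCompactSupport_normed.smul_right
  rw [← integral_sub (hint y) (hint z)]
  calc _ ≤ ∫ t, f.normed volume t * ‖y - z‖ := by
        refine norm_integral_le_of_norm_le (f.integrable_normed.mul_const _) (.of_forall fun t => ?_)
        rw [← smul_sub, norm_smul, Real.norm_of_nonneg (f.nonneg_normed t)]
        refine mul_le_mul_of_nonneg_left ?_ (f.nonneg_normed t)
        simpa using hΦ (y - t) (z - t)
    _ = ‖y - z‖ := by rw [integral_mul_const, f.integral_normed, one_mul]

open MeasureTheory in
/-- Mollifying by a normalized bump function, which is even, fixes the identity. -/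
theorem integral_normed_smul_sub {E : Type*} [NormedAddCommGroup E] [InnerProductSpace ℝ E]
    [FiniteDimensional ℝ E] [MeasurableSpace E] [BorelSpace E]
    (f : ContDiffBump (0 : E)) (y : E) :
    ∫ t, f.normed volume t • (y - t) = y := by
  have hint : Integrable (fun t => f.normed volume t • t) :=
    (f.continuous_normed.smul continuous_id).integrable_of_hasCompactSupport
      f.hasCompactSupport_normed.smul_right
  have h0 : ∫ t, f.normed volume t • t = 0 := by
    have h := integral_neg_eq_self (fun t => f.normed volume t • t) volume
    simp only [f.normed_neg, smul_neg, integral_neg] at h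
    have : IsAddTorsionFree E := .of_isTorsionFree ℝ E
    exact self_eq_neg.mp h.symm
  simp only [smul_sub]
  rw [integral_sub (f.integrable_normed.smul_const y) hint, h0, integral_smul_const,
    f.integral_normed, one_smul, sub_zero]

/-- The radial map with profile `g` is `1`-Lipschitz if `g` is and `0 ≤ g r ≤ r`. -/
theorem norm_radial_sub_le {E : Type*} [NormedAddCommGroup E] [InnerProductSpace ℝ E]
    {g : ℝ → ℝ} (hg : ∀ r s, |g r - g s| ≤ |r - s|) (h0 : ∀ r, 0 ≤ r → 0 ≤ g r)
    (hle : ∀ r, 0 ≤ r → g r ≤ r) (y z : E) :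
    ‖(g ‖y‖ / ‖y‖) • y - (g ‖z‖ / ‖z‖) • z‖ ≤ ‖y - z‖ := by
  have hn (x : E) : ‖(g ‖x‖ / ‖x‖) • x‖ ≤ ‖x‖ := by
    rw [norm_smul, Real.norm_of_nonneg (div_nonneg (h0 _ (norm_nonneg x)) (norm_nonneg x))]
    exact mul_le_of_le_one_left (norm_nonneg x)
      (div_le_one_of_le₀ (hle _ (norm_nonneg x)) (norm_nonneg x))
  rcases eq_or_ne y 0 with rfl | hy
  · simpa using hn z
  rcases eq_or_ne z 0 with rfl | hz
  · simpa using hn y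
  have hr : 0 < ‖y‖ := norm_pos_iff.mpr hy
  have hs : 0 < ‖z‖ := norm_pos_iff.mpr hz
  refine le_of_sq_le_sq ?_ (norm_nonneg _)
  rw [@norm_sub_sq_real, @norm_sub_sq_real, norm_smul, norm_smul, inner_smul_left,
    inner_smul_right, Real.norm_eq_abs, Real.norm_eq_abs, mul_pow, mul_pow, sq_abs, sq_abs]
  have hgs := sq_le_sq.mpr (hg ‖y‖ ‖z‖)
  have ha := h0 _ hr.le
  have hb := h0 _ hs.le
  have ha' := hle _ hr.le
  have hb' := hle _ hs.le
  obtain ⟨c, hc⟩ : ∃ c, inner ℝ y z = ‖y‖ * ‖z‖ * c :=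
    ⟨inner ℝ y z / (‖y‖ * ‖z‖), by field_simp⟩
  have hc1 : c ≤ 1 := by
    have h := real_inner_le_norm y z
    rw [hc] at h
    exact le_of_mul_le_mul_left (by simpa using h) (mul_pos hr hs)
  rw [hc]
  generalize ‖y‖ = r at *
  generalize ‖z‖ = s at *
  have hab : g r * g s ≤ r * s := mul_le_mul ha' hb' hb hr.le
  have hmul := mul_le_mul_of_nonneg_right hab (sub_nonneg.mpr hc1)
  have e1 : (g r / r) ^ 2 * r ^ 2 = g r ^ 2 := by field_simp
  have e2 : (g s / s) ^ 2 * s ^ 2 = g s ^ 2 := by field_simp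
  have e3 : g r / r * (g s / s * (r * s * c)) = g r * g s * c := by field_simp
  simp only [conj_trivial]
  rw [e1, e2, e3]
  linarith

open MeasureTheory in
/-- For every integer `k ≥ 1` and every real `σ > 2` there exists a smooth
compactly supported map `ψ : ℝ^k → ℝ^k` which is the identity on the unit ball, vanishes
outside the ball of radius `σ`, is bounded by `σ` and is `1`-Lipschitz. -/
theorem exists_truncation (k : ℕ) (hk : 1 ≤ k) (σ : ℝ) (hσ : 2 < σ) :
    ∃ ψ : EuclideanSpace ℝ (Fin k) → EuclideanSpace ℝ (Fin k),
      ContDiff ℝ (⊤ : ℕ∞) ψ ∧ HasCompactSupport ψ ∧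
      (∀ y, ‖y‖ ≤ 1 → ψ y = y) ∧
      (∀ y, σ ≤ ‖y‖ → ψ y = 0) ∧
      (∀ y, ‖ψ y‖ ≤ σ) ∧
      (∀ y z, ‖ψ y - ψ z‖ ≤ ‖y - z‖) := by
  obtain ⟨δ, hδ, hσδ⟩ : ∃ δ : ℝ, 0 < δ ∧ σ = 2 + 3 * δ := ⟨(σ - 2) / 3, by linarith, by ring⟩
  let g : ℝ → ℝ := fun r => min r (max (2 + 2 * δ - r) 0)
  let Φ : EuclideanSpace ℝ (Fin k) → EuclideanSpace ℝ (Fin k) := fun y => (g ‖y‖ / ‖y‖) • y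
  have hΦ : ∀ y z, ‖Φ y - Φ z‖ ≤ ‖y - z‖ := by
    refine norm_radial_sub_le (fun r s => ?_) (fun r hr => le_min hr (le_max_right _ _))
      (fun r _ => min_le_left _ _)
    refine (abs_min_sub_min_le_max _ _ _ _).trans (max_le le_rfl ?_)
    refine (abs_max_sub_max_le_max _ _ _ _).trans (max_le (le_of_eq ?_) (by simp))
    rw [abs_sub_comm r s]
    congr 1
    ring
  have hΦc : Continuous Φ :=
    (LipschitzWith.of_dist_le_mul (K := 1) fun y z => by
      simpa [dist_eq_norm] using hΦ y z).continuous
  have hΦid (y) (hy : ‖y‖ ≤ 1 + δ) : Φ y = y := by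
    rcases eq_or_ne y 0 with rfl | h0
    · simp [Φ]
    · have : g ‖y‖ = ‖y‖ := min_eq_left (le_max_of_le_left (by linarith))
      simp only [Φ]
      rw [this, div_self (norm_ne_zero_iff.mpr h0), one_smul]
  have hΦ0 (y) (hy : 2 + 2 * δ ≤ ‖y‖) : Φ y = 0 := by
    have : g ‖y‖ = 0 := by
      simp only [g]
      rw [max_eq_right (by linarith), min_eq_right (norm_nonneg y)]
    simp [Φ, this]
  let f : ContDiffBump (0 : EuclideanSpace ℝ (Fin k)) := ⟨δ / 2, δ, by positivity, by linarith⟩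
  have hf (t) (ht : δ ≤ ‖t‖) : f.normed volume t = 0 := by
    rw [ContDiffBump.normed_def, f.zero_of_le_dist (by simpa [f] using ht), zero_div]
  let ψ : EuclideanSpace ℝ (Fin k) → EuclideanSpace ℝ (Fin k) :=
    fun y => ∫ t, f.normed volume t • Φ (y - t)
  have hlip : ∀ y z, ‖ψ y - ψ z‖ ≤ ‖y - z‖ := norm_convolution_normed_sub_le f hΦ hΦc
  have hid (y) (hy : ‖y‖ ≤ 1) : ψ y = y := by
    refine Eq.trans (integral_congr_ae (.of_forall fun t => ?_)) (integral_normed_smul_sub f y)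
    rcases le_total δ ‖t‖ with ht | ht
    · simp [hf t ht]
    · simp only
      rw [hΦid _ ((norm_sub_le y t).trans (by linarith))]
  have hzero (y) (hy : σ ≤ ‖y‖) : ψ y = 0 := by
    refine integral_eq_zero_of_ae (.of_forall fun t => ?_)
    rcases le_total δ ‖t‖ with ht | ht
    · simp [hf t ht]
    · simp only
      rw [hΦ0 _ (by linarith [norm_sub_norm_le y t]), smul_zero, Pi.zero_apply]
  refine ⟨ψ, ?_, ?_, hid, hzero, fun y => ?_, hlip⟩
  · exact f.hasCompactSupport_normed.contDiff_convolution_left (μ := volume)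
      (ContinuousLinearMap.lsmul ℝ ℝ) f.contDiff_normed hΦc.locallyIntegrable
  · refine HasCompactSupport.intro (isCompact_closedBall 0 σ) fun y hy => hzero y ?_
    simpa using (lt_of_not_ge (by simpa using hy)).le
  · rcases le_total σ ‖y‖ with hy | hy
    · rw [hzero y hy, norm_zero]
      linarith
    · have h := hlip y 0
      rw [hid 0 (by simp), sub_zero, sub_zero] at h
      exact h.trans hy
end

section
/- Let k, d ≥ 1 be integers, let α ∈ (0,1), c7 > 0, c3, c4 ≥ 0, and let f : ℝ^{k×d} → [0,+∞) satisfy f(ξ) ≤ c3·Σ_{i=1}^k |ξ^i| + c4 for every ξ. Then the following are equivalent: (i) for every s, t > 0 and every ξ ∈ ℝ^{k×d}, |f(sξ)/s − f(tξ)/t| ≤ (c7/s)·f(sξ)^{1−α} + c7/s + (c7/t)·f(tξ)^{1−α} + c7/t; (ii) for every ξ ∈ ℝ^{k×d} the limit f^∞(ξ) := lim_{s→+∞} f(sξ)/s exists in ℝ, and |f(sξ)/s − f^∞(ξ)| ≤ c7/s + (c7/s)·f(sξ)^{1−α} for every s > 0 and every ξ ∈ ℝ^{k×d}. -/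
open Filter

/-- The Euclidean norm of the `i`-th row of a `k × d` real matrix. -/
noncomputable def rowNorm {k d : ℕ} (ξ : Matrix (Fin k) (Fin d) ℝ) (i : Fin k) : ℝ :=
  Real.sqrt (∑ j, (ξ i j) ^ 2)

theorem rowNorm_smul {k d : ℕ} {s : ℝ} (hs : 0 ≤ s) (ξ : Matrix (Fin k) (Fin d) ℝ) (i : Fin k) :
    rowNorm (s • ξ) i = s * rowNorm ξ i := by
  simp only [rowNorm, Matrix.smul_apply, smul_eq_mul, mul_pow, ← Finset.mul_sum]
  rw [Real.sqrt_mul (sq_nonneg s), Real.sqrt_sq hs]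

/-- A sublinear power of a function of at most linear growth is `o(s)`. -/
theorem tendsto_div_add_div_mul_rpow_of_le_linear {g : ℝ → ℝ} {α A B c : ℝ}
    (hα0 : 0 < α) (hα1 : α < 1) (hB : 0 ≤ B)
    (hg0 : ∀ s, 0 ≤ g s) (hg : ∀ s, 0 < s → g s ≤ s * A + B) :
    Tendsto (fun s : ℝ => c / s + (c / s) * g s ^ (1 - α)) atTop (nhds 0) := by
  have hpow : Tendsto (fun s : ℝ => g s ^ (1 - α) / s) atTop (nhds 0) := by
    have hlim : Tendsto (fun s : ℝ => (A + B) ^ (1 - α) * s ^ (-α)) atTop (nhds 0) := by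
      simpa using (tendsto_rpow_neg_atTop hα0).const_mul ((A + B) ^ (1 - α))
    refine tendsto_of_tendsto_of_tendsto_of_le_of_le' tendsto_const_nhds hlim ?_ ?_
    · filter_upwards [eventually_ge_atTop 0] with s hs
      exact div_nonneg (Real.rpow_nonneg (hg0 s) _) hs
    · filter_upwards [eventually_ge_atTop 1] with s hs
      have hs0 : 0 < s := by linarith
      have hAB : 0 ≤ A + B := by linarith [hg0 1, hg 1 one_pos]
      have hle : g s ≤ (A + B) * s := by nlinarith [hg s hs0]
      rw [div_le_iff₀ hs0]
      calc g s ^ (1 - α) ≤ ((A + B) * s) ^ (1 - α) :=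
            Real.rpow_le_rpow (hg0 s) hle (by linarith)
        _ = (A + B) ^ (1 - α) * s ^ (-α + 1) := by
            rw [Real.mul_rpow hAB hs0.le, neg_add_eq_sub]
        _ = (A + B) ^ (1 - α) * s ^ (-α) * s := by
            rw [Real.rpow_add_one hs0.ne', mul_assoc]
  have hsum := (tendsto_const_nhds (x := c)).div_atTop tendsto_id |>.add (hpow.const_mul c)
  rw [mul_zero, add_zero] at hsum
  refine hsum.congr fun s => ?_
  simp only [id]
  ring

/-- If the error `e` vanishes at infinity, the two-parameter estimate `|h s - h t| ≤ e s + e t`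
is equivalent to convergence of `h` at rate `e`. -/
theorem forall_abs_sub_le_add_iff_exists_tendsto {h e : ℝ → ℝ} (he : Tendsto e atTop (nhds 0)) :
    (∀ s t : ℝ, 0 < s → 0 < t → |h s - h t| ≤ e s + e t) ↔
      ∃ L : ℝ, Tendsto h atTop (nhds L) ∧ ∀ s : ℝ, 0 < s → |h s - L| ≤ e s := by
  constructor
  · intro H
    have hcauchy : CauchySeq h := by
      refine Metric.cauchySeq_iff.2 fun ε hε => ?_
      obtain ⟨N, hN⟩ := eventually_atTop.1
        ((he.eventually_lt_const (half_pos hε)).and (eventually_gt_atTop 0))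
      refine ⟨N, fun m hm n hn => ?_⟩
      rw [Real.dist_eq]
      linarith [H m n (hN m hm).2 (hN n hn).2, (hN m hm).1, (hN n hn).1]
    obtain ⟨L, hL⟩ := cauchySeq_tendsto_of_complete hcauchy
    refine ⟨L, hL, fun s hs => ?_⟩
    have hright : Tendsto (fun t => e s + e t) atTop (nhds (e s)) := by
      simpa using he.const_add (e s)
    refine le_of_tendsto_of_tendsto (hL.const_sub (h s)).abs hright ?_
    filter_upwards [eventually_gt_atTop 0] with t ht using H s t hs ht
  · rintro ⟨L, -, hL⟩ s t hs ht
    have htri := abs_sub_le (h s) L (h t)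
    rw [abs_sub_comm L] at htri
    linarith [hL s hs, hL t ht]

/-- characterisation of the class `𝓕^α`: for a nonnegative integrand with linear
growth, the two-parameter estimate (i) is equivalent to the existence of the limit
`f^∞(ξ) = lim_{s→+∞} f(sξ)/s` together with the one-parameter estimate (ii). -/
theorem falpha_characterisation (k d : ℕ) (hk : 1 ≤ k) (hd : 1 ≤ d)
    (α c7 c3 c4 : ℝ) (hα0 : 0 < α) (hα1 : α < 1) (hc7 : 0 < c7) (hc3 : 0 ≤ c3) (hc4 : 0 ≤ c4)
    (f : Matrix (Fin k) (Fin d) ℝ → ℝ)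
    (hnonneg : ∀ ξ, 0 ≤ f ξ)
    (hup : ∀ ξ, f ξ ≤ c3 * (∑ i, rowNorm ξ i) + c4) :
    (∀ s t : ℝ, 0 < s → 0 < t → ∀ ξ,
        |f (s • ξ) / s - f (t • ξ) / t| ≤
          (c7 / s) * f (s • ξ) ^ (1 - α) + c7 / s
            + (c7 / t) * f (t • ξ) ^ (1 - α) + c7 / t)
      ↔
    (∀ ξ, ∃ L : ℝ, Tendsto (fun s : ℝ => f (s • ξ) / s) atTop (nhds L) ∧
        ∀ s : ℝ, 0 < s →
          |f (s • ξ) / s - L| ≤ c7 / s + (c7 / s) * f (s • ξ) ^ (1 - α)) := by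
  have key : ∀ ξ, (∀ s t : ℝ, 0 < s → 0 < t → |f (s • ξ) / s - f (t • ξ) / t| ≤
      (c7 / s + (c7 / s) * f (s • ξ) ^ (1 - α)) + (c7 / t + (c7 / t) * f (t • ξ) ^ (1 - α))) ↔
      ∃ L : ℝ, Tendsto (fun s : ℝ => f (s • ξ) / s) atTop (nhds L) ∧
        ∀ s : ℝ, 0 < s → |f (s • ξ) / s - L| ≤ c7 / s + (c7 / s) * f (s • ξ) ^ (1 - α) := by
    intro ξ
    refine forall_abs_sub_le_add_iff_exists_tendsto
      (h := fun s => f (s • ξ) / s) (e := fun s => c7 / s + (c7 / s) * f (s • ξ) ^ (1 - α))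
      (tendsto_div_add_div_mul_rpow_of_le_linear (A := c3 * ∑ i, rowNorm ξ i)
        hα0 hα1 hc4 (fun s => hnonneg _) fun s hs => ?_)
    have hle := hup (s • ξ)
    simp only [rowNorm_smul hs.le, ← Finset.mul_sum] at hle
    linarith
  constructor
  · intro H ξ
    exact (key ξ).1 fun s t hs ht => by linarith [H s t hs ht ξ]
  · intro H s t hs ht ξ
    linarith [(key ξ).2 (H ξ) s t hs ht]
end

section
/- Let k, d ≥ 1 be integers, let c1 > 0, c3 > 0, let θ : [0,+∞) → [0,+∞) be continuous, nondecreasing, with θ(0) = 0, and let g : ℝ^k × S^{d−1} → [0,+∞) satisfy c1·Σ_{i=1}^k min(|ζ_i|, 1) ≤ g(ζ,ν) ≤ c3·Σ_{i=1}^k min(|ζ_i|, 1) for every ζ ∈ ℝ^k and ν ∈ S^{d−1}. Then the following are equivalent: (i) for every s, t > 0, ζ ∈ ℝ^k, ν ∈ S^{d−1}, |g(sζ,ν)/s − g(tζ,ν)/t| ≤ θ(s|ζ|)·g(sζ,ν)/s + θ(t|ζ|)·g(tζ,ν)/t; (ii) for every ζ ∈ ℝ^k and ν ∈ S^{d−1}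 the limit g^0(ζ,ν) := lim_{s→0⁺} g(sζ,ν)/s exists in ℝ and |g(sζ,ν)/s − g^0(ζ,ν)| ≤ θ(s|ζ|)·g(sζ,ν)/s for every s > 0. Moreover, in this case θ(s|ζ|)·g(sζ,ν)/s ≤ c3·k·θ(s|ζ|)·|ζ| for every s > 0, ζ, ν. -/
open Filter
open scoped Topology

/-- If the increments of a bounded function are controlled by a weight vanishing along a filter,
then the function converges along that filter. -/
theorem exists_tendsto_of_abs_sub_le_weighted {α : Type*} {l : Filter α} [l.NeBot]
    {F w : α → ℝ} {M : ℝ} (hw : Tendsto w l (𝓝 0))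
    (hF : ∀ᶠ x in l, 0 ≤ w x ∧ F x ≤ M)
    (h : ∀ᶠ p in l ×ˢ l, |F p.1 - F p.2| ≤ w p.1 * F p.1 + w p.2 * F p.2) :
    ∃ L, Tendsto F l (𝓝 L) := by
  rw [← cauchy_map_iff_exists_tendsto, cauchy_map_iff', tendsto_uniformity_iff_dist_tendsto_zero]
  have hlim : Tendsto (fun p : α × α => w p.1 * M + w p.2 * M) (l ×ˢ l) (𝓝 0) := by
    simpa using ((hw.comp tendsto_fst).mul_const M).add ((hw.comp tendsto_snd).mul_const M)
  refine squeeze_zero' (Eventually.of_forall fun _ => dist_nonneg) ?_ hlim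
  filter_upwards [h, hF.prod_mk hF] with p hp hb
  rw [Real.dist_eq]
  exact hp.trans (add_le_add (mul_le_mul_of_nonneg_left hb.1.2 hb.1.1)
    (mul_le_mul_of_nonneg_left hb.2.2 hb.2.1))

theorem sum_min_abs_one_le_card_mul_norm {k : ℕ} (ζ : EuclideanSpace ℝ (Fin k)) :
    ∑ i, min |ζ i| 1 ≤ k * ‖ζ‖ := by
  calc ∑ i, min |ζ i| 1 ≤ ∑ _i : Fin k, ‖ζ‖ :=
        Finset.sum_le_sum fun i _ => (min_le_left _ _).trans (PiLp.norm_apply_le ζ i)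
    _ = k * ‖ζ‖ := by simp

/-- characterisation of the class `𝓖^θ`: for a surface integrand `g` with the
standard growth bounds, the two-parameter estimate (i) is equivalent to the existence of the
limit `g⁰(ζ,ν) = lim_{s→0⁺} g(sζ,ν)/s` together with the one-parameter estimate (ii);
moreover, in this case `θ(s|ζ|)·g(sζ,ν)/s ≤ c3·k·θ(s|ζ|)·|ζ|`. -/
theorem gtheta_characterisation (k d : ℕ) (hk : 1 ≤ k) (hd : 1 ≤ d)
    (c1 c3 : ℝ) (hc1 : 0 < c1) (hc3 : 0 < c3)
    (θ : ℝ → ℝ) (hθc : ContinuousOn θ (Set.Ici 0)) (hθm : MonotoneOn θ (Set.Ici 0))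
    (hθ0 : θ 0 = 0) (hθnn : ∀ t : ℝ, 0 ≤ t → 0 ≤ θ t)
    (g : EuclideanSpace ℝ (Fin k) → Metric.sphere (0 : EuclideanSpace ℝ (Fin d)) 1 → ℝ)
    (hlow : ∀ ζ ν, c1 * (∑ i, min |ζ i| 1) ≤ g ζ ν)
    (hup : ∀ ζ ν, g ζ ν ≤ c3 * (∑ i, min |ζ i| 1)) :
    ((∀ s t : ℝ, 0 < s → 0 < t → ∀ ζ ν,
        |g (s • ζ) ν / s - g (t • ζ) ν / t| ≤
          θ (s * ‖ζ‖) * (g (s • ζ) ν / s) + θ (t * ‖ζ‖) * (g (t • ζ) ν / t))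
      ↔
      (∀ ζ ν, ∃ L : ℝ,
        Tendsto (fun s : ℝ => g (s • ζ) ν / s) (𝓝[>] (0 : ℝ)) (𝓝 L) ∧
        ∀ s : ℝ, 0 < s →
          |g (s • ζ) ν / s - L| ≤ θ (s * ‖ζ‖) * (g (s • ζ) ν / s))) ∧
    ((∀ s t : ℝ, 0 < s → 0 < t → ∀ ζ ν,
        |g (s • ζ) ν / s - g (t • ζ) ν / t| ≤
          θ (s * ‖ζ‖) * (g (s • ζ) ν / s) + θ (t * ‖ζ‖) * (g (t • ζ) ν / t)) →
      ∀ s : ℝ, 0 < s → ∀ ζ ν,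
        θ (s * ‖ζ‖) * (g (s • ζ) ν / s) ≤ c3 * k * θ (s * ‖ζ‖) * ‖ζ‖) := by
  have hbd : ∀ s : ℝ, 0 < s → ∀ ζ ν, g (s • ζ) ν / s ≤ c3 * k * ‖ζ‖ := by
    intro s hs ζ ν
    rw [div_le_iff₀ hs]
    calc g (s • ζ) ν ≤ c3 * (k * ‖s • ζ‖) := (hup _ ν).trans
          (mul_le_mul_of_nonneg_left (sum_min_abs_one_le_card_mul_norm _) hc3.le)
      _ = c3 * k * ‖ζ‖ * s := by rw [norm_smul, Real.norm_of_nonneg hs.le]; ring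
  have hθs : ∀ s : ℝ, 0 < s → ∀ ζ : EuclideanSpace ℝ (Fin k), 0 ≤ θ (s * ‖ζ‖) :=
    fun s hs ζ => hθnn _ (by positivity)
  have hpos : ∀ᶠ s : ℝ in 𝓝[>] (0 : ℝ), 0 < s := eventually_mem_nhdsWithin
  have hθt : ∀ ζ : EuclideanSpace ℝ (Fin k),
      Tendsto (fun s : ℝ => θ (s * ‖ζ‖)) (𝓝[>] (0 : ℝ)) (𝓝 0) := by
    intro ζ
    have hθ : Tendsto θ (𝓝[≥] (0 : ℝ)) (𝓝 0) := by
      simpa [ContinuousWithinAt, hθ0] using hθc 0 Set.self_mem_Ici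
    refine hθ.comp (tendsto_nhdsWithin_iff.2 ⟨?_, ?_⟩)
    · have : Tendsto (fun s : ℝ => s * ‖ζ‖) (𝓝 0) (𝓝 (0 * ‖ζ‖)) := tendsto_id.mul_const _
      rw [zero_mul] at this
      exact this.mono_left nhdsWithin_le_nhds
    · filter_upwards [hpos] with s hs
      exact mul_nonneg hs.le (norm_nonneg ζ)
  refine ⟨⟨fun h ζ ν => ?_, fun h s t hs ht ζ ν => ?_⟩, fun _ s hs ζ ν => ?_⟩
  · obtain ⟨L, hL⟩ := exists_tendsto_of_abs_sub_le_weighted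
      (F := fun s : ℝ => g (s • ζ) ν / s) (hθt ζ)
      (hpos.mono fun s hs => ⟨hθs s hs ζ, hbd s hs ζ ν⟩)
      ((hpos.prod_mk hpos).mono fun p hp => h p.1 p.2 hp.1 hp.2 ζ ν)
    refine ⟨L, hL, fun s hs => ?_⟩
    have hright := ((hθt ζ).mul hL).const_add (θ (s * ‖ζ‖) * (g (s • ζ) ν / s))
    rw [zero_mul, add_zero] at hright
    exact le_of_tendsto_of_tendsto (hL.const_sub _).abs hright
      (hpos.mono fun t ht => h s t hs ht ζ ν)
  · obtain ⟨L, -, hL⟩ := h ζ ν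
    refine (abs_sub_le _ L _).trans (add_le_add (hL s hs) ?_)
    rw [abs_sub_comm]
    exact hL t ht
  · calc θ (s * ‖ζ‖) * (g (s • ζ) ν / s) ≤ θ (s * ‖ζ‖) * (c3 * k * ‖ζ‖) :=
          mul_le_mul_of_nonneg_left (hbd s hs ζ ν) (hθs s hs ζ)
      _ = c3 * k * θ (s * ‖ζ‖) * ‖ζ‖ := by ring
end

section
/- Let d, k ≥ 1, let σ > 2, let ψ be a σ-truncation function on ℝ^k, and let c4, C ≥ 0. Let A₁, A₂ ⊆ ℝ^d be bounded open sets and for j = 1, 2 let E_j be a functional assigning to each Lebesgue-measurable u : A_j → ℝ^k a value E_j(u) ∈ [0,+∞], such that: (lsc) whenever measurable functions u_n converge in measure on A_j to u, one has E_j(u) ≤ liminf_n E_j(u_n); (trunc) for every measurable u : A_j → ℝ^k, every R > 0 and every integer m ≥ 1, (1/m)·Σ_{i=1}^m E_j(ψ_R^i ∘ u) ≤ E_j(u) + c4·L^d({x ∈ A_j : |u(x)| ≥ R}) + (C/m)·(E_j(u) + L^d(A_j)). Then for all measurable u₁ : A₁ → ℝ^k and u₂ : A₂ → ℝ^k there exists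 a strictly increasing sequence of positive reals R_m → +∞ such that E_j(ψ_{R_m} ∘ u_j) → E_j(u_j) in [0,+∞] as m → +∞, for both j = 1 and j = 2. -/
open Filter MeasureTheory
open scoped Topology ENNReal

/-- A `σ`-truncation function on `ℝ^k`: smooth, compactly supported, identity on the unit
ball, vanishing outside the ball of radius `σ`, bounded by `σ`, and `1`-Lipschitz. -/
def IsTruncation {k : ℕ} (σ : ℝ)
    (ψ : EuclideanSpace ℝ (Fin k) → EuclideanSpace ℝ (Fin k)) : Prop :=
  ContDiff ℝ (⊤ : ℕ∞) ψ ∧ HasCompactSupport ψ ∧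
    (∀ y, ‖y‖ ≤ 1 → ψ y = y) ∧ (∀ y, σ ≤ ‖y‖ → ψ y = 0) ∧
    (∀ y, ‖ψ y‖ ≤ σ) ∧ (∀ y z, ‖ψ y - ψ z‖ ≤ ‖y - z‖)

/-- The rescaled truncation `ψ_R(y) := R · ψ(y/R)`. -/
noncomputable def psiR {k : ℕ} (ψ : EuclideanSpace ℝ (Fin k) → EuclideanSpace ℝ (Fin k))
    (R : ℝ) (y : EuclideanSpace ℝ (Fin k)) : EuclideanSpace ℝ (Fin k) :=
  R • ψ (R⁻¹ • y)

/-- Convergence in measure on a set `A ⊆ ℝ^d` of a sequence of functions with values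
in `ℝ^k`. -/
def ConvInMeasure {d k : ℕ} (A : Set (EuclideanSpace ℝ (Fin d)))
    (un : ℕ → EuclideanSpace ℝ (Fin d) → EuclideanSpace ℝ (Fin k))
    (u : EuclideanSpace ℝ (Fin d) → EuclideanSpace ℝ (Fin k)) : Prop :=
  ∀ η : ℝ, 0 < η →
    Tendsto (fun n => volume {x ∈ A | η < ‖un n x - u x‖}) atTop (𝓝 (0 : ℝ≥0∞))

/-- If averages of finitely many functions along geometric progressions are asymptotically bounded
by constants `e j`, which are also asymptotic lower bounds, then all functions are simultaneously
close to these constants at arbitrarily large arguments. -/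
lemma frequently_forall_le_add {ι : Type*} (S : Finset ι) {e K : ι → ℝ≥0∞} {a v : ι → ℝ → ℝ≥0∞}
    {σ : ℝ} (hσ : 1 ≤ σ) (he : ∀ j ∈ S, e j ≠ ∞) (hK : ∀ j ∈ S, K j ≠ ∞)
    (hv : ∀ j ∈ S, Tendsto (v j) atTop (𝓝 0))
    (havg : ∀ j ∈ S, ∀ R : ℝ, 0 < R → ∀ m : ℕ, 1 ≤ m →
      (m : ℝ≥0∞)⁻¹ * ∑ i ∈ Finset.range m, a j (σ ^ i * R) ≤ e j + v j R + K j / m)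
    (hlow : ∀ j ∈ S, ∀ δ : ℝ≥0∞, δ ≠ 0 → ∀ᶠ R in atTop, e j ≤ a j R + δ)
    {ε : ℝ≥0∞} (hε : ε ≠ 0) :
    ∃ᶠ R in atTop, ∀ j ∈ S, a j R ≤ e j + ε := by
  classical
  set δ : ℝ≥0∞ := ε / (S.card + 1 : ℕ)
  have hδ : δ ≠ 0 := ENNReal.div_ne_zero.2 ⟨hε, ENNReal.natCast_ne_top _⟩
  have hδε : (S.card + 1 : ℕ) * δ = ε :=
    ENNReal.mul_div_cancel (by simp) (ENNReal.natCast_ne_top _)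
  have hδ2 : 0 < δ / 2 := ENNReal.half_pos hδ
  have hvS : Tendsto (fun R => ∑ j ∈ S, v j R) atTop (𝓝 0) := by
    simpa using tendsto_finsetSum S hv
  have hKS : Tendsto (fun m : ℕ => ∑ j ∈ S, K j / (m : ℝ≥0∞)) atTop (𝓝 0) := by
    have h : ∀ j ∈ S, Tendsto (fun m : ℕ => K j / (m : ℝ≥0∞)) atTop (𝓝 0) := fun j hj => by
      simpa [div_eq_mul_inv] using
        ENNReal.Tendsto.const_mul ENNReal.tendsto_inv_nat_nhds_zero (Or.inr (hK j hj))
    simpa using tendsto_finsetSum S h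
  have hlowS : ∀ᶠ R in atTop, ∀ j ∈ S, e j ≤ a j R + δ :=
    (Filter.eventually_all_finset S).2 fun j hj => hlow j hj δ hδ
  rw [Filter.frequently_atTop]
  intro N
  obtain ⟨N', hN'⟩ := Filter.eventually_atTop.1 hlowS
  obtain ⟨R, hRv, hR⟩ := ((hvS.eventually_lt_const hδ2).and
    (Filter.eventually_ge_atTop (max 1 (max N N')))).exists
  obtain ⟨m, hmK, hm⟩ := ((hKS.eventually_lt_const hδ2).and (Filter.eventually_ge_atTop 1)).exists
  obtain ⟨hR1, hRN, hRN'⟩ : 1 ≤ R ∧ N ≤ R ∧ N' ≤ R := by simpa using hR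
  have hm0 : (m : ℝ≥0∞) ≠ 0 := by simp; omega
  have hsum : ∑ i ∈ Finset.range m, ∑ j ∈ S, a j (σ ^ i * R) ≤
      ∑ _i ∈ Finset.range m, (∑ j ∈ S, e j + δ) := by
    have h := Finset.sum_le_sum fun j hj => havg j hj R (by linarith) m hm
    rw [← Finset.mul_sum, Finset.sum_comm, Finset.sum_add_distrib, Finset.sum_add_distrib] at h
    rw [Finset.sum_const, Finset.card_range, nsmul_eq_mul,
      ← ENNReal.inv_mul_le_iff hm0 (ENNReal.natCast_ne_top _)]
    refine h.trans ?_
    rw [add_assoc]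
    gcongr
    exact (add_le_add hRv.le hmK.le).trans_eq (ENNReal.add_halves δ)
  obtain ⟨i, hi⟩ : ∃ i, ∑ j ∈ S, a j (σ ^ i * R) ≤ ∑ j ∈ S, e j + δ := by
    by_contra! hlt
    exact hsum.not_gt
      (ENNReal.sum_lt_sum_of_nonempty (Finset.nonempty_range_iff.2 (by omega)) fun i _ => hlt i)
  have hge : R ≤ σ ^ i * R := le_mul_of_one_le_left (by linarith) (one_le_pow₀ hσ)
  refine ⟨σ ^ i * R, hRN.trans hge, fun j hj => ?_⟩
  have hfin : ∑ l ∈ S.erase j, e l ≠ ∞ :=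
    ENNReal.sum_ne_top.2 fun l hl => he l (Finset.mem_of_mem_erase hl)
  refine (ENNReal.add_le_add_iff_right hfin).1 ?_
  calc a j (σ ^ i * R) + ∑ l ∈ S.erase j, e l
      ≤ a j (σ ^ i * R) + ∑ l ∈ S.erase j, (a l (σ ^ i * R) + δ) := by
        gcongr with l hl
        exact hN' _ (hRN'.trans hge) l (Finset.mem_of_mem_erase hl)
    _ = ∑ l ∈ S, a l (σ ^ i * R) + (S.erase j).card * δ := by
        rw [Finset.sum_add_distrib, ← add_assoc, Finset.add_sum_erase S (fun l => a l (σ ^ i * R)) hj]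
        simp
    _ ≤ ∑ l ∈ S, e l + δ + S.card * δ := by
        gcongr
        exact Finset.erase_subset _ _
    _ = e j + ε + ∑ l ∈ S.erase j, e l := by
        rw [← Finset.add_sum_erase S e hj, ← hδε]
        push_cast
        ring

/-- A property holding frequently for each `n` is realised along a strictly increasing sequence
of positive reals tending to infinity. -/
lemma exists_strictMono_of_frequently {P : ℕ → ℝ → Prop} (hP : ∀ n, ∃ᶠ R in atTop, P n R) :
    ∃ R : ℕ → ℝ, StrictMono R ∧ (∀ n, 0 < R n) ∧ Tendsto R atTop atTop ∧ ∀ n, P n (R n) := by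
  choose f hf hPf using fun n N => Filter.frequently_atTop.1 (hP n) N
  let R : ℕ → ℝ := fun n => Nat.rec (f 0 1) (fun n r => f (n + 1) (r + 1)) n
  have hstep : ∀ n, R n + 1 ≤ R (n + 1) := fun n => hf (n + 1) (R n + 1)
  have hge : ∀ n : ℕ, (n : ℝ) + 1 ≤ R n := by
    intro n
    induction n with
    | zero => simpa [R] using hf 0 1
    | succ n ih => push_cast; linarith [hstep n]
  refine ⟨R, strictMono_nat_of_lt_succ fun n => by linarith [hstep n],
    fun n => by linarith [hge n, n.cast_nonneg (α := ℝ)],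
    tendsto_atTop_mono (fun n => by linarith [hge n]) tendsto_natCast_atTop_atTop, fun n => ?_⟩
  cases n with
  | zero => exact hPf 0 1
  | succ n => exact hPf (n + 1) (R n + 1)

lemma psiR_eq_self {k : ℕ} {σ : ℝ} {ψ : EuclideanSpace ℝ (Fin k) → EuclideanSpace ℝ (Fin k)}
    (hψ : IsTruncation σ ψ) {R : ℝ} (hR : 0 < R) {y : EuclideanSpace ℝ (Fin k)} (hy : ‖y‖ ≤ R) :
    psiR ψ R y = y := by
  have h : ‖R⁻¹ • y‖ ≤ 1 := by
    rw [norm_smul, norm_inv, Real.norm_of_nonneg hR.le, inv_mul_le_iff₀ hR]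
    simpa using hy
  rw [psiR, hψ.2.2.1 _ h, smul_inv_smul₀ hR.ne']

lemma measurable_psiR {k : ℕ} {σ : ℝ} {ψ : EuclideanSpace ℝ (Fin k) → EuclideanSpace ℝ (Fin k)}
    (hψ : IsTruncation σ ψ) (R : ℝ) : Measurable (psiR ψ R) :=
  (hψ.1.continuous.comp (continuous_const_smul R⁻¹)).const_smul R |>.measurable

lemma tendsto_measure_le_norm_atTop {α F : Type*} [MeasurableSpace α] {μ : Measure α}
    [NormedAddCommGroup F] [MeasurableSpace F] [OpensMeasurableSpace F] {A : Set α}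
    (hA : MeasurableSet A) (hμA : μ A ≠ ∞) {u : α → F} (hu : Measurable u) :
    Tendsto (fun R : ℝ => μ {x ∈ A | R ≤ ‖u x‖}) atTop (𝓝 0) := by
  have hempty : ⋂ R : ℝ, {x ∈ A | R ≤ ‖u x‖} = ∅ := by
    refine Set.eq_empty_of_forall_notMem fun x hx => ?_
    have := (Set.mem_iInter.1 hx (‖u x‖ + 1)).2
    linarith
  have h := tendsto_measure_iInter_atTop (μ := μ) (s := fun R : ℝ => {x ∈ A | R ≤ ‖u x‖})
    (fun R => (hA.inter (measurableSet_le measurable_const hu.norm)).nullMeasurableSet)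
    (fun R R' hRR' x hx => ⟨hx.1, hRR'.trans hx.2⟩)
    ⟨0, measure_ne_top_of_subset (fun x hx => hx.1) hμA⟩
  rw [hempty, measure_empty] at h
  exact h

lemma convInMeasure_psiR_comp {d k : ℕ} {σ : ℝ}
    {ψ : EuclideanSpace ℝ (Fin k) → EuclideanSpace ℝ (Fin k)} (hψ : IsTruncation σ ψ)
    {A : Set (EuclideanSpace ℝ (Fin d))} (hA : MeasurableSet A) (hvol : volume A ≠ ∞)
    {u : EuclideanSpace ℝ (Fin d) → EuclideanSpace ℝ (Fin k)} (hu : Measurable u)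
    {R : ℕ → ℝ} (hR : Tendsto R atTop atTop) :
    ConvInMeasure A (fun n => psiR ψ (R n) ∘ u) u := by
  intro η hη
  refine tendsto_of_tendsto_of_tendsto_of_le_of_le' tendsto_const_nhds
    ((tendsto_measure_le_norm_atTop hA hvol hu).comp hR) (Eventually.of_forall fun _ => zero_le)
    ((hR.eventually_gt_atTop 0).mono fun n hn => measure_mono fun x hx => ⟨hx.1, ?_⟩)
  by_contra! hlt
  have := hx.2
  simp only [Function.comp_apply, psiR_eq_self hψ hn hlt.le, sub_self, norm_zero] at this
  linarith

/-- A sequential lower bound for the lower limit gives an approximate lower bound at all large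
arguments. -/
lemma eventually_le_add_of_forall_seq {a : ℝ → ℝ≥0∞} {e : ℝ≥0∞} (he : e ≠ ∞)
    (h : ∀ R : ℕ → ℝ, Tendsto R atTop atTop → e ≤ liminf (fun n => a (R n)) atTop)
    {δ : ℝ≥0∞} (hδ : δ ≠ 0) : ∀ᶠ R in atTop, e ≤ a R + δ := by
  by_contra hne
  obtain ⟨R, hR, hlt⟩ := Filter.exists_seq_forall_of_frequently (Filter.not_eventually.1 hne)
  have he0 : e ≠ 0 := fun h0 => hlt 0 (by simp [h0])
  have hsub : e - δ < liminf (fun n => a (R n)) atTop :=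
    (ENNReal.sub_lt_self he he0 hδ).trans_le (h R hR)
  obtain ⟨n, hn⟩ := (eventually_lt_of_lt_liminf hsub).exists
  exact hlt n (tsub_le_iff_right.1 hn.le)

/-- for two lower semicontinuous functionals satisfying the averaged truncation
estimate, there is a common strictly increasing sequence `R_m → +∞` along which the energies
of the truncations `ψ_{R_m} ∘ u_j` converge to the energies of `u_j`. -/
theorem truncation_convergence (d k : ℕ) (hd : 1 ≤ d) (hk : 1 ≤ k)
    (σ : ℝ) (hσ : 2 < σ)
    (ψ : EuclideanSpace ℝ (Fin k) → EuclideanSpace ℝ (Fin k)) (hψ : IsTruncation σ ψ)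
    (c4 C : ℝ) (hc4 : 0 ≤ c4) (hC : 0 ≤ C)
    (A : Fin 2 → Set (EuclideanSpace ℝ (Fin d)))
    (hAopen : ∀ j, IsOpen (A j)) (hAbdd : ∀ j, Bornology.IsBounded (A j))
    (E : Fin 2 → (EuclideanSpace ℝ (Fin d) → EuclideanSpace ℝ (Fin k)) → ℝ≥0∞)
    -- lower semicontinuity with respect to convergence in measure on `A j`
    (hlsc : ∀ j, ∀ u, Measurable u →
      ∀ un : ℕ → EuclideanSpace ℝ (Fin d) → EuclideanSpace ℝ (Fin k),
        (∀ n, Measurable (un n)) → ConvInMeasure (A j) un u →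
        E j u ≤ liminf (fun n => E j (un n)) atTop)
    -- the averaged truncation estimate (property (g) with `w = 0`)
    (htrunc : ∀ j, ∀ u, Measurable u → ∀ R : ℝ, 0 < R → ∀ m : ℕ, 1 ≤ m →
      (m : ℝ≥0∞)⁻¹ * ∑ i ∈ Finset.range m, E j (psiR ψ (σ ^ i * R) ∘ u) ≤
        E j u + ENNReal.ofReal c4 * volume {x ∈ A j | R ≤ ‖u x‖}
          + (ENNReal.ofReal C / (m : ℝ≥0∞)) * (E j u + volume (A j))) :
    ∀ u : Fin 2 → EuclideanSpace ℝ (Fin d) → EuclideanSpace ℝ (Fin k),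
      (∀ j, Measurable (u j)) →
      ∃ R : ℕ → ℝ, StrictMono R ∧ (∀ m, 0 < R m) ∧ Tendsto R atTop atTop ∧
        ∀ j, Tendsto (fun m => E j (psiR ψ (R m) ∘ u j)) atTop (𝓝 (E j (u j))) := by
  classical
  intro u hu
  have hvol : ∀ j, volume (A j) ≠ ∞ := fun j => (hAbdd j).measure_lt_top.ne
  have hliminf : ∀ j, ∀ R : ℕ → ℝ, Tendsto R atTop atTop →
      E j (u j) ≤ liminf (fun n => E j (psiR ψ (R n) ∘ u j)) atTop := fun j R hR =>
    hlsc j (u j) (hu j) _ (fun n => (measurable_psiR hψ (R n)).comp (hu j))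
      (convInMeasure_psiR_comp hψ (hAopen j).measurableSet (hvol j) (hu j) hR)
  let S : Finset (Fin 2) := Finset.univ.filter fun j => E j (u j) ≠ ∞
  have hS : ∀ j ∈ S, E j (u j) ≠ ∞ := fun j hj => (Finset.mem_filter.1 hj).2
  have hfreq : ∀ n : ℕ, ∃ᶠ R in atTop, ∀ j ∈ S,
      E j (psiR ψ R ∘ u j) ≤ E j (u j) + (n : ℝ≥0∞)⁻¹ := fun n =>
    frequently_forall_le_add S (e := fun j => E j (u j)) (a := fun j R => E j (psiR ψ R ∘ u j))
      (K := fun j => ENNReal.ofReal C * (E j (u j) + volume (A j)))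
      (v := fun j R => ENNReal.ofReal c4 * volume {x ∈ A j | R ≤ ‖u j x‖})
      (by linarith : (1 : ℝ) ≤ σ) hS
      (fun j hj => ENNReal.mul_ne_top ENNReal.ofReal_ne_top
        (ENNReal.add_ne_top.2 ⟨hS j hj, hvol j⟩))
      (fun j _ => by
        simpa using ENNReal.Tendsto.const_mul
          (tendsto_measure_le_norm_atTop (hAopen j).measurableSet (hvol j) (hu j))
          (Or.inr ENNReal.ofReal_ne_top))
      (fun j _ R hR m hm => by
        rw [ENNReal.mul_div_right_comm]
        exact htrunc j (u j) (hu j) R hR m hm)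
      (fun j hj δ hδ => eventually_le_add_of_forall_seq (hS j hj) (hliminf j) hδ)
      (ENNReal.inv_ne_zero.2 (ENNReal.natCast_ne_top n))
  obtain ⟨R, hmono, hpos, htop, hle⟩ := exists_strictMono_of_frequently hfreq
  refine ⟨R, hmono, hpos, htop, fun j => ?_⟩
  refine tendsto_of_le_liminf_of_limsup_le (hliminf j R htop) ?_
  by_cases hj : E j (u j) = ∞
  · simp [hj]
  · have hlim : Tendsto (fun n : ℕ => E j (u j) + (n : ℝ≥0∞)⁻¹) atTop (𝓝 (E j (u j))) := by
      simpa using ENNReal.tendsto_inv_nat_nhds_zero.const_add (E j (u j))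
    rw [← hlim.limsup_eq]
    exact limsup_le_limsup (Eventually.of_forall fun n => hle n j (by simp [S, hj]))
end

section
/- Let k ≥ 1 be an integer, let c1, c3 be reals with 0 < c1 ≤ 1 ≤ c3, and let θ : [0,+∞) → [0,+∞) be continuous, nondecreasing, with θ(0) = 0. Then the following are equivalent: (a) θ(t) ≥ (c1/c3)·t − 1 for every t ≥ 0; (b) there exists g : ℝ^k → [0,+∞) such that c1·Σ_{i=1}^k min(|ζ_i|, 1) ≤ g(ζ) ≤ c3·Σ_{i=1}^k min(|ζ_i|, 1) for every ζ ∈ ℝ^k and |g(sζ)/s − g(tζ)/t| ≤ θ(s|ζ|)·g(sζ)/s + θ(t|ζ|)·g(tζ)/t for every s, t > 0 and every ζ ∈ ℝ^k. Moreover, when (a) holds, the function g(ζ) := Σ_{i=1}^k min(c1·|ζ_i|, c3) satisfies all the conditions in (b). -/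
section TruncatedLinear

variable {c1 c3 : ℝ}

lemma mul_min_le_min_mul (hc1 : 0 < c1) (hc1le : c1 ≤ 1) (hc3 : 1 ≤ c3) (a : ℝ) :
    c1 * min a 1 ≤ min (c1 * a) c3 := by
  refine le_min (mul_le_mul_of_nonneg_left (min_le_left _ _) hc1.le) ?_
  nlinarith [min_le_right a 1]

lemma min_mul_le_mul_min (hc1le : c1 ≤ 1) (hc3 : 1 ≤ c3) {a : ℝ} (ha : 0 ≤ a) :
    min (c1 * a) c3 ≤ c3 * min a 1 := by
  rcases le_total a 1 with h | h
  · rw [min_eq_left h]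
    exact (min_le_left _ _).trans (mul_le_mul_of_nonneg_right (hc1le.trans hc3) ha)
  · rw [min_eq_right h, mul_one]
    exact min_le_right _ _

lemma min_mul_div_eq {s : ℝ} (hs : 0 < s) (a : ℝ) :
    min (c1 * (s * a)) c3 / s = min (c1 * a) (c3 / s) := by
  rw [← min_div_div_right hs.le]
  congr 1
  field_simp

lemma min_mul_div_anti (hc3 : 0 ≤ c3) {s t : ℝ} (hs : 0 < s) (hst : s ≤ t) (a : ℝ) :
    min (c1 * (t * a)) c3 / t ≤ min (c1 * (s * a)) c3 / s := by
  rw [min_mul_div_eq hs, min_mul_div_eq (hs.trans_le hst)]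
  gcongr

lemma min_mul_div_le_mul (hc1 : 0 < c1) (hc3 : 0 < c3) {s t a N x : ℝ} (hs : 0 < s) (ht : 0 < t)
    (ha : 0 ≤ a) (haN : a ≤ N) (hx : 0 ≤ x) (hxN : c1 / c3 * (t * N) - 1 ≤ x) :
    min (c1 * (s * a)) c3 / s ≤ (1 + x) * (min (c1 * (t * a)) c3 / t) := by
  rw [min_mul_div_eq hs, min_mul_div_eq ht]
  refine (min_le_left _ _).trans ?_
  rcases min_cases (c1 * a) (c3 / t) with ⟨h, -⟩ | ⟨h, -⟩ <;> rw [h]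
  · nlinarith [mul_nonneg hx (mul_nonneg hc1.le ha)]
  · calc c1 * a ≤ c1 * N := by gcongr
      _ = (c1 / c3 * (t * N)) * (c3 / t) := by field_simp
      _ ≤ (1 + x) * (c3 / t) := by
        gcongr
        linarith

variable {ι : Type*} [Fintype ι]

lemma abs_sum_min_div_sub_le (hc1 : 0 < c1) (hc3 : 0 < c3) {s t x y : ℝ} (hs : 0 < s)
    (hst : s ≤ t) (ζ : EuclideanSpace ℝ ι) (hy : 0 ≤ y) (hx : 0 ≤ x)
    (hxN : c1 / c3 * (t * ‖ζ‖) - 1 ≤ x) :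
    |(∑ i, min (c1 * |(s • ζ) i|) c3) / s - (∑ i, min (c1 * |(t • ζ) i|) c3) / t| ≤
      y * ((∑ i, min (c1 * |(s • ζ) i|) c3) / s) +
        x * ((∑ i, min (c1 * |(t • ζ) i|) c3) / t) := by
  have ht : 0 < t := hs.trans_le hst
  simp only [PiLp.smul_apply, smul_eq_mul, abs_mul, abs_of_pos hs, abs_of_pos ht]
  have hanti : (∑ i, min (c1 * (t * |ζ i|)) c3) / t ≤ (∑ i, min (c1 * (s * |ζ i|)) c3) / s := by
    rw [Finset.sum_div, Finset.sum_div]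
    exact Finset.sum_le_sum fun i _ => min_mul_div_anti hc3.le hs hst _
  have hle : (∑ i, min (c1 * (s * |ζ i|)) c3) / s ≤
      (1 + x) * ((∑ i, min (c1 * (t * |ζ i|)) c3) / t) := by
    rw [Finset.sum_div, Finset.sum_div, Finset.mul_sum]
    exact Finset.sum_le_sum fun i _ =>
      min_mul_div_le_mul hc1 hc3 hs ht (abs_nonneg _) (PiLp.norm_apply_le ζ i) hx hxN
  have hnonneg : 0 ≤ (∑ i, min (c1 * (s * |ζ i|)) c3) / s := by positivity
  rw [abs_of_nonneg (sub_nonneg.2 hanti)]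
  nlinarith [mul_nonneg hy hnonneg]

end TruncatedLinear

lemma growth_of_oscillation_le {c1 c3 : ℝ} {θ f : ℝ → ℝ} (hc3 : 0 < c3)
    (hθc : ContinuousOn θ (Set.Ici 0)) (hθ0 : θ 0 = 0) (hθnn : ∀ t : ℝ, 0 ≤ t → 0 ≤ θ t)
    (hlow : ∀ s, 0 < s → c1 * min s 1 ≤ f s) (hupp : ∀ s, 0 < s → f s ≤ c3 * min s 1)
    (hosc : ∀ s t, 0 < s → 0 < t → |f s / s - f t / t| ≤ θ s * (f s / s) + θ t * (f t / t))
    {t : ℝ} (ht : 0 ≤ t) : c1 / c3 * t - 1 ≤ θ t := by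
  rcases ht.eq_or_lt with rfl | ht
  · simp [hθ0]
  have hlim : Filter.Tendsto θ (nhdsWithin 0 (Set.Ioi 0)) (nhds 0) := by
    simpa [hθ0] using ((hθc 0 Set.self_mem_Ici).mono Set.Ioi_subset_Ici_self).tendsto
  have hbound : c1 * (1 - 0) ≤ (1 + θ t) * (c3 / t) := by
    refine le_of_tendsto ((hlim.const_sub 1).const_mul c1) ?_
    filter_upwards [self_mem_nhdsWithin, Ioo_mem_nhdsGT (zero_lt_one (α := ℝ)),
      hlim.eventually_lt_const one_pos] with s (hs : 0 < s) hs1 hθs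
    have hfs : c1 ≤ f s / s := by
      have := hlow s hs
      rw [min_eq_left hs1.2.le] at this
      rwa [le_div_iff₀ hs]
    have hft : f t / t ≤ c3 / t := by
      gcongr
      exact (hupp t ht).trans (mul_le_of_le_one_right hc3.le (min_le_right _ _))
    have := (le_abs_self _).trans (hosc s t hs ht)
    calc c1 * (1 - θ s) ≤ f s / s * (1 - θ s) := by
          gcongr
      _ ≤ (1 + θ t) * (f t / t) := by linarith
      _ ≤ (1 + θ t) * (c3 / t) := by
          gcongr
          linarith [hθnn t ht.le]
  have heq : c1 / c3 * t = c1 * (1 - 0) * (t / c3) := by ring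
  have : c1 / c3 * t ≤ 1 + θ t := by
    rw [heq]
    calc c1 * (1 - 0) * (t / c3) ≤ (1 + θ t) * (c3 / t) * (t / c3) := by gcongr
      _ = 1 + θ t := by field_simp
  linarith


/-- the growth condition `θ(t) ≥ (c1/c3)·t − 1` on `θ` is equivalent to the
existence of a surface integrand `g` with standard bounds satisfying the `𝓖^θ` oscillation
estimate; moreover, in that case `g(ζ) = Σ_i min(c1·|ζ_i|, c3)` is such an integrand. -/
theorem gtheta_nonempty_iff (k : ℕ) (hk : 1 ≤ k)
    (c1 c3 : ℝ) (hc1 : 0 < c1) (hc1le : c1 ≤ 1) (hc3 : 1 ≤ c3)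
    (θ : ℝ → ℝ) (hθc : ContinuousOn θ (Set.Ici 0)) (hθm : MonotoneOn θ (Set.Ici 0))
    (hθ0 : θ 0 = 0) (hθnn : ∀ t : ℝ, 0 ≤ t → 0 ≤ θ t) :
    ((∀ t : ℝ, 0 ≤ t → (c1 / c3) * t - 1 ≤ θ t) ↔
      (∃ g : EuclideanSpace ℝ (Fin k) → ℝ,
        (∀ ζ, c1 * (∑ i, min |ζ i| 1) ≤ g ζ ∧ g ζ ≤ c3 * (∑ i, min |ζ i| 1)) ∧
        (∀ s t : ℝ, 0 < s → 0 < t → ∀ ζ,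
          |g (s • ζ) / s - g (t • ζ) / t| ≤
            θ (s * ‖ζ‖) * (g (s • ζ) / s) + θ (t * ‖ζ‖) * (g (t • ζ) / t)))) ∧
    ((∀ t : ℝ, 0 ≤ t → (c1 / c3) * t - 1 ≤ θ t) →
      ((∀ ζ : EuclideanSpace ℝ (Fin k),
          c1 * (∑ i, min |ζ i| 1) ≤ (∑ i, min (c1 * |ζ i|) c3) ∧
          (∑ i, min (c1 * |ζ i|) c3) ≤ c3 * (∑ i, min |ζ i| 1)) ∧
       (∀ s t : ℝ, 0 < s → 0 < t → ∀ ζ : EuclideanSpace ℝ (Fin k),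
          |(∑ i, min (c1 * |(s • ζ) i|) c3) / s - (∑ i, min (c1 * |(t • ζ) i|) c3) / t| ≤
            θ (s * ‖ζ‖) * ((∑ i, min (c1 * |(s • ζ) i|) c3) / s)
              + θ (t * ‖ζ‖) * ((∑ i, min (c1 * |(t • ζ) i|) c3) / t)))) := by
  have hc3pos : 0 < c3 := one_pos.trans_le hc3
  have hmodel : (∀ t : ℝ, 0 ≤ t → (c1 / c3) * t - 1 ≤ θ t) →
      ((∀ ζ : EuclideanSpace ℝ (Fin k),
          c1 * (∑ i, min |ζ i| 1) ≤ (∑ i, min (c1 * |ζ i|) c3) ∧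
          (∑ i, min (c1 * |ζ i|) c3) ≤ c3 * (∑ i, min |ζ i| 1)) ∧
       (∀ s t : ℝ, 0 < s → 0 < t → ∀ ζ : EuclideanSpace ℝ (Fin k),
          |(∑ i, min (c1 * |(s • ζ) i|) c3) / s - (∑ i, min (c1 * |(t • ζ) i|) c3) / t| ≤
            θ (s * ‖ζ‖) * ((∑ i, min (c1 * |(s • ζ) i|) c3) / s)
              + θ (t * ‖ζ‖) * ((∑ i, min (c1 * |(t • ζ) i|) c3) / t))) := by
    intro h
    refine ⟨fun ζ => ?_, fun s t hs ht ζ => ?_⟩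
    · rw [Finset.mul_sum, Finset.mul_sum]
      exact ⟨Finset.sum_le_sum fun i _ => mul_min_le_min_mul hc1 hc1le hc3 _,
        Finset.sum_le_sum fun i _ => min_mul_le_mul_min hc1le hc3 (abs_nonneg _)⟩
    · have hsN : 0 ≤ s * ‖ζ‖ := by positivity
      have htN : 0 ≤ t * ‖ζ‖ := by positivity
      rcases le_total s t with hst | hst
      · exact abs_sum_min_div_sub_le hc1 hc3pos hs hst ζ (hθnn _ hsN) (hθnn _ htN) (h _ htN)
      · rw [abs_sub_comm, add_comm]
        exact abs_sum_min_div_sub_le hc1 hc3pos ht hst ζ (hθnn _ htN) (hθnn _ hsN) (h _ hsN)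
  refine ⟨⟨fun h => ⟨_, hmodel h⟩, ?_⟩, hmodel⟩
  rintro ⟨g, hg, hosc⟩ t ht
  let e : EuclideanSpace ℝ (Fin k) := EuclideanSpace.single ⟨0, hk⟩ 1
  have he : ‖e‖ = 1 := by simp [e]
  have hsum : ∀ s : ℝ, 0 < s → ∑ i, min |(s • e) i| 1 = min s 1 := by
    intro s hs
    rw [Finset.sum_eq_single ⟨0, hk⟩]
    · simp [e, abs_of_pos hs]
    · intro i _ hi
      simp [e, hi]
    · simp
  refine growth_of_oscillation_le (f := fun s => g (s • e)) hc3pos hθc hθ0 hθnn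
    (fun s hs => ?_) (fun s hs => ?_) (fun s t hs ht => ?_) ht
  · simpa only [hsum s hs] using (hg (s • e)).1
  · simpa only [hsum s hs] using (hg (s • e)).2
  · simpa only [he, mul_one] using hosc s t hs ht e
end
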